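/- arXiv:2511.09531 — 8 statements merged into one kernel-verified Lean document; each statement's English description precedes it below -/
import Mathlib

section
/- Let δ ∈ [0,1], let f : [0,1] → [0,1] be integrable, and let g : [0,1] → [0,1] be differentiable and non-increasing. If ∫_0^1 f(x) dx ≥ 1 − δ, then ∫_0^1 f(x)·g(x) dx ≥ ∫_δ^1 g(x) dx. -/
/-- Rearrangement-type lemma: if `f : [0,1] → [0,1]` has total integral at least `1 - δ`
and `g : [0,1] → [0,1]` is differentiable and non-increasing, then
`∫_0^1 f·g ≥ ∫_δ^1 g`. -/
theorem stmt0 (δ : ℝ) (hδ : δ ∈ Set.Icc (0:ℝ) 1)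
    (f g : ℝ → ℝ)
    (hf_int : IntervalIntegrable f MeasureTheory.volume 0 1)
    (hf_mem : ∀ x ∈ Set.Icc (0:ℝ) 1, f x ∈ Set.Icc (0:ℝ) 1)
    (hg_diff : DifferentiableOn ℝ g (Set.Icc 0 1))
    (hg_mono : AntitoneOn g (Set.Icc 0 1))
    (hg_mem : ∀ x ∈ Set.Icc (0:ℝ) 1, g x ∈ Set.Icc (0:ℝ) 1)
    (hf_mass : 1 - δ ≤ ∫ x in (0:ℝ)..1, f x) :
    (∫ x in δ..1, g x) ≤ ∫ x in (0:ℝ)..1, f x * g x := by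
  obtain ⟨hδ0, hδ1⟩ := hδ
  have hg_cont : ContinuousOn g (Set.uIcc 0 1) := by
    simpa [Set.uIcc_of_le] using hg_diff.continuousOn
  have left_sub : Set.uIcc 0 δ ⊆ Set.uIcc (0:ℝ) 1 := by
    rw [Set.uIcc_of_le hδ0, Set.uIcc_of_le zero_le_one]
    exact Set.Icc_subset_Icc_right hδ1
  have right_sub : Set.uIcc δ 1 ⊆ Set.uIcc (0:ℝ) 1 := by
    rw [Set.uIcc_of_le hδ1, Set.uIcc_of_le zero_le_one]
    exact Set.Icc_subset_Icc_left hδ0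
  have hfg_int := hf_int.mul_continuousOn hg_cont
  have hfc_int := hf_int.mul_const (g δ)
  have hg_int := (hg_cont.mono right_sub).intervalIntegrable (μ := MeasureTheory.volume)
  -- Compare with the constant weight `g δ` separately on each side of `δ`.
  have left_le : (∫ x in (0:ℝ)..δ, f x * g δ) ≤ ∫ x in (0:ℝ)..δ, f x * g x := by
    refine intervalIntegral.integral_mono_on hδ0 (hfc_int.mono_set left_sub)
      (hfg_int.mono_set left_sub) fun x hx => ?_
    have hx' : x ∈ Set.Icc (0:ℝ) 1 := ⟨hx.1, hx.2.trans hδ1⟩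
    exact mul_le_mul_of_nonneg_left (hg_mono hx' ⟨hδ0, hδ1⟩ hx.2) (hf_mem x hx').1
  have right_le : (∫ x in δ..1, (g x - g δ + f x * g δ)) ≤ ∫ x in δ..1, f x * g x := by
    refine intervalIntegral.integral_mono_on hδ1
      ((hg_int.sub intervalIntegrable_const).add (hfc_int.mono_set right_sub))
      (hfg_int.mono_set right_sub) fun x hx => ?_
    have hx' : x ∈ Set.Icc (0:ℝ) 1 := ⟨hδ0.trans hx.1, hx.2⟩
    nlinarith [mul_nonneg (sub_nonneg.2 (hf_mem x hx').2)
      (sub_nonneg.2 (hg_mono ⟨hδ0, hδ1⟩ hx' hx.1))]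
  rw [intervalIntegral.integral_add (hg_int.sub intervalIntegrable_const)
    (hfc_int.mono_set right_sub), intervalIntegral.integral_sub hg_int intervalIntegrable_const,
    intervalIntegral.integral_const, smul_eq_mul] at right_le
  have fc_split := intervalIntegral.integral_add_adjacent_intervals
    (hfc_int.mono_set left_sub) (hfc_int.mono_set right_sub)
  have fg_split := intervalIntegral.integral_add_adjacent_intervals
    (hfg_int.mono_set left_sub) (hfg_int.mono_set right_sub)
  rw [intervalIntegral.integral_mul_const (a := 0) (b := 1)] at fc_split
  have mass_le := mul_le_mul_of_nonneg_right hf_mass (hg_mem δ ⟨hδ0, hδ1⟩).1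
  linarith
end

section
/- Let ε > 0, λ' > 0, δ ∈ [0,1] and α ≥ 1, and let f : [0,ε] → [0,1] be integrable with ∫_0^ε f(t)·(λ' e^{−λ' t}/(1 − e^{−λ' ε})) dt ≥ 1 − δ. Then ∫_0^ε f(t)·α λ' e^{−α λ' t} dt ≥ (1 − δ(1 − e^{−λ' ε}))^α − e^{−α λ' ε}, and consequently ∫_0^ε f(t)·α λ' e^{−α λ' t} dt ≥ e^{−α δ λ' ε} − e^{−α λ' ε}. -/
lemma integral_mul_exp_neg_mul (a s ε : ℝ) :
    ∫ t in s..ε, a * Real.exp (-(a * t)) = Real.exp (-(a * s)) - Real.exp (-(a * ε)) := by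
  have hderiv : ∀ t ∈ Set.uIcc s ε,
      HasDerivAt (fun t => -Real.exp (-(a * t))) (a * Real.exp (-(a * t))) t := by
    intro t _
    refine ((hasDerivAt_id t).const_mul a).neg.exp.neg.congr_deriv ?_
    simp [mul_comm]
  rw [intervalIntegral.integral_eq_sub_of_hasDerivAt hderiv
    (Continuous.intervalIntegrable (by fun_prop) _ _)]
  ring

lemma exp_neg_mul_le_one_sub_mul {δ : ℝ} (hδ : δ ∈ Set.Icc (0 : ℝ) 1) (x : ℝ) :
    Real.exp (-(δ * x)) ≤ 1 - δ * (1 - Real.exp (-x)) := by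
  have h := convexOn_exp.2 (Set.mem_univ 0) (Set.mem_univ (-x))
    (sub_nonneg.2 hδ.2) hδ.1 (sub_add_cancel 1 δ)
  simp only [smul_eq_mul, mul_zero, zero_add, mul_neg, Real.exp_zero, mul_one] at h
  linarith

/-- Bathtub principle: a `[0,1]`-valued function integrates a weight `k` that is nonnegative
before `s` and nonpositive after `s` to at least the integral of `k` after `s`. -/
lemma integral_le_integral_mul_of_sign_change {f k : ℝ → ℝ} {s ε : ℝ} (hs : 0 ≤ s) (hsε : s ≤ ε)
    (hf_int : IntervalIntegrable f MeasureTheory.volume 0 ε)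
    (hf_mem : ∀ t ∈ Set.Icc (0 : ℝ) ε, f t ∈ Set.Icc (0 : ℝ) 1)
    (hk : Continuous k) (hk_nonneg : ∀ t ≤ s, 0 ≤ k t) (hk_nonpos : ∀ t, s ≤ t → k t ≤ 0) :
    ∫ t in s..ε, k t ≤ ∫ t in (0 : ℝ)..ε, f t * k t := by
  have hfk := hf_int.mul_continuousOn hk.continuousOn
  have hs_mem : s ∈ Set.uIcc 0 ε := Set.mem_uIcc_of_le hs hsε
  have hleft : IntervalIntegrable (fun t => f t * k t) MeasureTheory.volume 0 s :=
    hfk.mono_set (Set.uIcc_subset_uIcc_left hs_mem)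
  have hright : IntervalIntegrable (fun t => f t * k t) MeasureTheory.volume s ε :=
    hfk.mono_set (Set.uIcc_subset_uIcc_right hs_mem)
  rw [← intervalIntegral.integral_add_adjacent_intervals hleft hright]
  have h₁ : 0 ≤ ∫ t in (0 : ℝ)..s, f t * k t :=
    intervalIntegral.integral_nonneg hs fun t ht =>
      mul_nonneg (hf_mem t ⟨ht.1, ht.2.trans hsε⟩).1 (hk_nonneg t ht.2)
  have h₂ : ∫ t in s..ε, k t ≤ ∫ t in s..ε, f t * k t :=
    intervalIntegral.integral_mono_on hsε (hk.intervalIntegrable _ _) hright fun t ht => by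
      nlinarith [(hf_mem t ⟨hs.trans ht.1, ht.2⟩).2, hk_nonpos t ht.1]
  linarith

/-- Key analytic step of Lemma `sec-cant-stop-early`: mass of `f` against the
first-arrival density of a rate-`lam` Poisson process on `[0,ε]` being at least `1 - δ`
lower bounds the mass against the density of a faster rate-`α·lam` process. -/
theorem stmt1 (ε lam δ α : ℝ) (hε : 0 < ε) (hlam : 0 < lam)
    (hδ : δ ∈ Set.Icc (0:ℝ) 1) (hα : 1 ≤ α)
    (f : ℝ → ℝ) (hf_int : IntervalIntegrable f MeasureTheory.volume 0 ε)
    (hf_mem : ∀ t ∈ Set.Icc (0:ℝ) ε, f t ∈ Set.Icc (0:ℝ) 1)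
    (hmass : 1 - δ ≤
      ∫ t in (0:ℝ)..ε, f t * (lam * Real.exp (-(lam * t)) / (1 - Real.exp (-(lam * ε))))) :
    (1 - δ * (1 - Real.exp (-(lam * ε)))) ^ α - Real.exp (-(α * lam * ε)) ≤
      (∫ t in (0:ℝ)..ε, f t * (α * lam * Real.exp (-(α * lam * t)))) ∧
    Real.exp (-(α * δ * lam * ε)) - Real.exp (-(α * lam * ε)) ≤
      ∫ t in (0:ℝ)..ε, f t * (α * lam * Real.exp (-(α * lam * t))) := by
  obtain ⟨hδ₀, hδ₁⟩ := hδ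
  have hE : 0 < 1 - Real.exp (-(lam * ε)) := by
    have : Real.exp (-(lam * ε)) < 1 := by
      rw [← Real.exp_zero, Real.exp_lt_exp]
      nlinarith
    linarith
  have hq_exp := exp_neg_mul_le_one_sub_mul ⟨hδ₀, hδ₁⟩ (lam * ε)
  obtain ⟨q, hq⟩ : ∃ q, q = 1 - δ * (1 - Real.exp (-(lam * ε))) := ⟨_, rfl⟩
  rw [← hq] at hq_exp ⊢
  have hq_pos : 0 < q := (Real.exp_pos _).trans_le hq_exp
  have hq_le : q ≤ 1 := by nlinarith
  have hq_ge : Real.exp (-(lam * ε)) ≤ q := by nlinarith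
  obtain ⟨s, hs⟩ : ∃ s, s = -Real.log q / lam := ⟨_, rfl⟩
  have hls : lam * s = -Real.log q := by rw [hs]; field_simp
  have hqs : Real.exp (-(lam * s)) = q := by rw [hls, neg_neg, Real.exp_log hq_pos]
  have hs₀ : 0 ≤ s := by
    rw [hs]
    exact div_nonneg (neg_nonneg.2 (Real.log_nonpos hq_pos.le hq_le)) hlam.le
  have hsε : s ≤ ε := by
    rw [← hqs, Real.exp_le_exp] at hq_ge
    nlinarith
  have hqα : Real.exp (-(α * lam * s)) = q ^ α := by
    rw [Real.rpow_def_of_pos hq_pos, mul_assoc, hls]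
    congr 1
    ring
  have hmass' : q - Real.exp (-(lam * ε)) ≤
      ∫ t in (0 : ℝ)..ε, f t * (lam * Real.exp (-(lam * t))) := by
    simp only [← mul_div_assoc, intervalIntegral.integral_div] at hmass ⊢
    rw [le_div_iff₀ hE] at hmass
    linarith
  obtain ⟨c, hc⟩ : ∃ c, c = α * Real.exp (-((α - 1) * lam * s)) := ⟨_, rfl⟩
  have hc₀ : 0 ≤ c := by rw [hc]; positivity
  have hfactor : ∀ t, α * lam * Real.exp (-(α * lam * t)) - c * (lam * Real.exp (-(lam * t))) =
      α * lam * Real.exp (-(lam * t)) *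
        (Real.exp (-((α - 1) * lam * t)) - Real.exp (-((α - 1) * lam * s))) := by
    intro t
    have : Real.exp (-(α * lam * t)) =
        Real.exp (-(lam * t)) * Real.exp (-((α - 1) * lam * t)) := by
      rw [← Real.exp_add]
      congr 1
      ring
    rw [this, hc]
    ring
  have hrate : 0 ≤ (α - 1) * lam := mul_nonneg (sub_nonneg.2 hα) hlam.le
  have hkey := integral_le_integral_mul_of_sign_change
    (k := fun t => α * lam * Real.exp (-(α * lam * t)) - c * (lam * Real.exp (-(lam * t))))
    hs₀ hsε hf_int hf_mem (by fun_prop)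
    (fun t ht => by
      simp only [hfactor]
      exact mul_nonneg (by positivity) (sub_nonneg.2 (Real.exp_le_exp.2
        (neg_le_neg (mul_le_mul_of_nonneg_left ht hrate)))))
    (fun t ht => by
      simp only [hfactor]
      exact mul_nonpos_of_nonneg_of_nonpos (by positivity) (sub_nonpos.2 (Real.exp_le_exp.2
        (neg_le_neg (mul_le_mul_of_nonneg_left ht hrate)))))
  rw [intervalIntegral.integral_sub (Continuous.intervalIntegrable (by fun_prop) _ _)
    (Continuous.intervalIntegrable (by fun_prop) _ _), integral_mul_exp_neg_mul,
    intervalIntegral.integral_const_mul, integral_mul_exp_neg_mul, hqα, hqs] at hkey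
  simp only [mul_sub, mul_left_comm _ c] at hkey
  rw [intervalIntegral.integral_sub
    (hf_int.mul_continuousOn (Continuous.continuousOn (by fun_prop)))
    ((hf_int.mul_continuousOn (Continuous.continuousOn (by fun_prop))).const_mul c),
    intervalIntegral.integral_const_mul] at hkey
  have hmain : q ^ α - Real.exp (-(α * lam * ε)) ≤
      ∫ t in (0 : ℝ)..ε, f t * (α * lam * Real.exp (-(α * lam * t))) := by
    nlinarith [mul_le_mul_of_nonneg_left hmass' hc₀]
  have hpow : Real.exp (-(α * δ * lam * ε)) ≤ q ^ α := by
    have h := Real.rpow_le_rpow (Real.exp_pos _).le hq_exp (by linarith : 0 ≤ α)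
    rw [← Real.exp_mul] at h
    convert h using 2
    ring
  exact ⟨hmain, by linarith⟩
end

section
/- For every t ∈ [0,1), there exists a unique real number c with c > −t(1 − ln t) (interpreting −t(1 − ln t) = 0 when t = 0) such that ∫_t^1 1/(c + y(1 − ln y)) dy = 1. -/
lemma mul_one_sub_log_mono {t y : ℝ} (ht : 0 ≤ t) (hty : t ≤ y) (hy : y ≤ 1) :
    t * (1 - Real.log t) ≤ y * (1 - Real.log y) := by
  have hlog : Real.log y ≤ 0 := Real.log_nonpos (ht.trans hty) hy
  rcases ht.eq_or_lt with rfl | ht0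
  · rw [zero_mul]
    exact mul_nonneg hty (by linarith)
  · have hy0 : 0 < y := ht0.trans_le hty
    have h := Real.log_le_sub_one_of_pos (div_pos hy0 ht0)
    rw [Real.log_div hy0.ne' ht0.ne'] at h
    have h2 : t * (Real.log y - Real.log t) ≤ y - t := by
      calc t * (Real.log y - Real.log t) ≤ t * (y / t - 1) :=
            mul_le_mul_of_nonneg_left h ht
        _ = y - t := by field_simp
    nlinarith [mul_nonneg (sub_nonneg.2 hty) (neg_nonneg.2 hlog)]

lemma mul_one_sub_log_subadd {t y : ℝ} (ht : 0 ≤ t) (hty : t < y) :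
    y * (1 - Real.log y) ≤ t * (1 - Real.log t) + (y - t) * (1 - Real.log (y - t)) := by
  have h1 : Real.log (y - t) ≤ Real.log y := Real.log_le_log (by linarith) (by linarith)
  rcases ht.eq_or_lt with rfl | ht0
  · simp
  · have h2 : Real.log t ≤ Real.log y := Real.log_le_log ht0 hty.le
    nlinarith [mul_le_mul_of_nonneg_left h2 ht,
      mul_le_mul_of_nonneg_left h1 (sub_nonneg.2 hty.le)]

lemma continuous_mul_one_sub_log : Continuous fun y : ℝ => y * (1 - Real.log y) := by
  have h : (fun y : ℝ => y * (1 - Real.log y)) = fun y => y - y * Real.log y := by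
    ext y; ring
  rw [h]
  exact continuous_id.sub Real.continuous_mul_log

lemma continuousOn_one_div_add_mul_one_sub_log {t c : ℝ} (ht : 0 ≤ t)
    (hc : -(t * (1 - Real.log t)) < c) :
    ContinuousOn (fun y : ℝ => 1 / (c + y * (1 - Real.log y))) (Set.Icc t 1) := by
  refine continuousOn_const.div
    (continuous_const.add continuous_mul_one_sub_log).continuousOn fun y hy => ?_
  have := mul_one_sub_log_mono ht hy.1 hy.2
  exact (by linarith : 0 < c + y * (1 - Real.log y)).ne'

lemma integral_one_div_add_mul_one_sub_log_lt {t c d : ℝ} (ht : 0 ≤ t) (ht1 : t < 1)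
    (hc : -(t * (1 - Real.log t)) < c) (hcd : c < d) :
    ∫ y in t..1, 1 / (d + y * (1 - Real.log y)) <
      ∫ y in t..1, 1 / (c + y * (1 - Real.log y)) := by
  have key : ∀ y ∈ Set.Icc t 1,
      1 / (d + y * (1 - Real.log y)) < 1 / (c + y * (1 - Real.log y)) := fun y hy => by
    have := mul_one_sub_log_mono ht hy.1 hy.2
    exact one_div_lt_one_div_of_lt (by linarith) (by linarith)
  exact intervalIntegral.integral_lt_integral_of_continuousOn_of_le_of_exists_lt ht1
    (continuousOn_one_div_add_mul_one_sub_log ht (hc.trans hcd))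
    (continuousOn_one_div_add_mul_one_sub_log ht hc)
    (fun y hy => (key y (Set.Ioc_subset_Icc_self hy)).le)
    ⟨1, Set.right_mem_Icc.2 ht1.le, key 1 (Set.right_mem_Icc.2 ht1.le)⟩

lemma continuousOn_integral_one_div_add_mul_one_sub_log {t a : ℝ} (ht : 0 ≤ t) (ht1 : t < 1)
    (ha : -(t * (1 - Real.log t)) < a) :
    ContinuousOn (fun c : ℝ => ∫ y in t..1, 1 / (c + y * (1 - Real.log y))) (Set.Ici a) := by
  have hcont : Continuous fun c : ℝ => ∫ y in t..1,
      1 / (max c a + max (y * (1 - Real.log y)) (t * (1 - Real.log t))) := by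
    refine intervalIntegral.continuous_parametric_intervalIntegral_of_continuous' ?_ t 1
    refine continuous_const.div (((continuous_fst.max continuous_const)).add
      ((continuous_mul_one_sub_log.comp continuous_snd).max continuous_const)) fun p => ?_
    have h1 := le_max_right p.1 a
    have h2 := le_max_right (p.2 * (1 - Real.log p.2)) (t * (1 - Real.log t))
    exact (by linarith : 0 < max p.1 a +
      max (p.2 * (1 - Real.log p.2)) (t * (1 - Real.log t))).ne'
  refine hcont.continuousOn.congr fun c hc => ?_
  refine intervalIntegral.integral_congr fun y hy => ?_
  rw [Set.uIcc_of_le ht1.le] at hy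
  simp only [max_eq_left (Set.mem_Ici.1 hc), max_eq_left (mul_one_sub_log_mono ht hy.1 hy.2)]

lemma integral_one_div_two_mul_one_sub_log {t δ : ℝ} (hδ : 0 < δ) (ht : 0 ≤ t)
    (hδt : δ ≤ 1 - t) :
    IntervalIntegrable (fun y : ℝ => 1 / (2 * ((y - t) * (1 - Real.log (y - t)))))
      MeasureTheory.volume (t + δ) 1 ∧
    ∫ y in (t + δ)..1, 1 / (2 * ((y - t) * (1 - Real.log (y - t)))) =
      (Real.log (1 - Real.log δ) - Real.log (1 - Real.log (1 - t))) / 2 := by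
  have hle : t + δ ≤ 1 := by linarith
  have hpos : ∀ y ∈ Set.uIcc (t + δ) 1, 0 < y - t ∧ 0 < 1 - Real.log (y - t) := by
    intro y hy
    rw [Set.uIcc_of_le hle] at hy
    have h0 : 0 < y - t := by linarith [hy.1]
    have := Real.log_nonpos h0.le (by linarith [hy.2])
    exact ⟨h0, by linarith⟩
  have hint : IntervalIntegrable (fun y : ℝ => 1 / (2 * ((y - t) * (1 - Real.log (y - t)))))
      MeasureTheory.volume (t + δ) 1 := by
    refine ContinuousOn.intervalIntegrable (continuousOn_const.div (continuousOn_const.mul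
      (continuous_mul_one_sub_log.comp (continuous_id.sub continuous_const)).continuousOn)
      fun y hy => ?_)
    obtain ⟨h1, h2⟩ := hpos y hy
    exact (mul_pos two_pos (mul_pos h1 h2)).ne'
  refine ⟨hint, ?_⟩
  rw [intervalIntegral.integral_eq_sub_of_hasDerivAt
    (f := fun y => -Real.log (1 - Real.log (y - t)) / 2) (fun y hy => ?_) hint]
  · simp only [add_sub_cancel_left]
    ring
  · obtain ⟨h1, h2⟩ := hpos y hy
    have hd := ((((((hasDerivAt_id y).sub_const t).log h1.ne').const_sub 1).log
      h2.ne').neg).div_const 2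
    refine hd.congr_deriv ?_
    simp only [id]
    field_simp

lemma exists_one_le_integral_one_div_add_mul_one_sub_log {t : ℝ} (ht : 0 ≤ t) (ht1 : t < 1) :
    ∃ a : ℝ, -(t * (1 - Real.log t)) < a ∧ a ≤ 1 ∧
      1 ≤ ∫ y in t..1, 1 / (a + y * (1 - Real.log y)) := by
  have hL : Real.log (1 - t) ≤ 0 := Real.log_nonpos (by linarith) (by linarith)
  have hφt : 0 ≤ t * (1 - Real.log t) := by
    simpa using mul_one_sub_log_mono le_rfl ht ht1.le
  have he : (1 : ℝ) ≤ Real.exp 2 := Real.one_le_exp (by norm_num)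
  obtain ⟨δ, hδ, hδlog⟩ : ∃ δ : ℝ, 0 < δ ∧
      1 - Real.log δ = Real.exp 2 * (1 - Real.log (1 - t)) :=
    ⟨Real.exp (1 - Real.exp 2 * (1 - Real.log (1 - t))), Real.exp_pos _, by
      rw [Real.log_exp]; ring⟩
  have hδt : δ ≤ 1 - t := by
    rw [← Real.log_le_log_iff hδ (by linarith)]
    nlinarith
  have ha : -(t * (1 - Real.log t)) < δ - t * (1 - Real.log t) := by linarith
  obtain ⟨hint, hval⟩ := integral_one_div_two_mul_one_sub_log hδ ht hδt
  rw [hδlog, Real.log_mul (Real.exp_pos 2).ne' (by linarith), Real.log_exp] at hval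
  have hcont := continuousOn_one_div_add_mul_one_sub_log ht ha
  refine ⟨δ - t * (1 - Real.log t), ha, by linarith, ?_⟩
  calc (1 : ℝ) = ∫ y in (t + δ)..1, 1 / (2 * ((y - t) * (1 - Real.log (y - t)))) := by
        rw [hval]; ring
    _ ≤ ∫ y in (t + δ)..1, 1 / (δ - t * (1 - Real.log t) + y * (1 - Real.log y)) := by
        refine intervalIntegral.integral_mono_on (by linarith) hint
          ((hcont.mono (Set.Icc_subset_Icc_left (by linarith))).intervalIntegrable_of_Icc
            (by linarith)) fun y hy => ?_
        have h1 := mul_one_sub_log_mono ht (by linarith [hy.1]) hy.2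
        have h2 := mul_one_sub_log_subadd ht (by linarith [hy.1] : t < y)
        have h3 : Real.log (y - t) ≤ 0 :=
          Real.log_nonpos (by linarith [hy.1]) (by linarith [hy.2])
        refine one_div_le_one_div_of_le (by linarith) ?_
        nlinarith [mul_nonneg (by linarith [hy.1] : 0 ≤ y - t) (neg_nonneg.2 h3), hy.1]
    _ ≤ ∫ y in t..1, 1 / (δ - t * (1 - Real.log t) + y * (1 - Real.log y)) := by
        refine intervalIntegral.integral_mono_interval (by linarith) (by linarith) le_rfl ?_
          (hcont.intervalIntegrable_of_Icc ht1.le)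
        filter_upwards [MeasureTheory.ae_restrict_mem measurableSet_Ioc] with y hy
        have h1 := mul_one_sub_log_mono ht hy.1.le hy.2
        exact one_div_nonneg.2 (by linarith)

lemma integral_one_div_one_add_mul_one_sub_log_le {t : ℝ} (ht : 0 ≤ t) (ht1 : t < 1) :
    ∫ y in t..1, 1 / (1 + y * (1 - Real.log y)) ≤ 1 := by
  have hφt : 0 ≤ t * (1 - Real.log t) := by
    simpa using mul_one_sub_log_mono le_rfl ht ht1.le
  calc ∫ y in t..1, 1 / (1 + y * (1 - Real.log y)) ≤ ∫ _ in t..1, (1 : ℝ) := by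
        refine intervalIntegral.integral_mono_on ht1.le
          ((continuousOn_one_div_add_mul_one_sub_log ht
            (by linarith)).intervalIntegrable_of_Icc ht1.le)
          intervalIntegrable_const fun y hy => ?_
        have h1 := mul_one_sub_log_mono ht hy.1 hy.2
        exact (div_le_one (by linarith)).2 (by linarith)
    _ ≤ 1 := by
        rw [intervalIntegral.integral_const, smul_eq_mul]
        linarith

/-- Well-definedness of the truncated Kertz constant: for every `t ∈ [0,1)` there is a
unique `c > −t(1 − ln t)` with `∫_t^1 1/(c + y(1 − ln y)) dy = 1`.
(Note `Real.log 0 = 0`, so the convention `−t(1 − ln t) = 0` at `t = 0` is automatic.) -/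
theorem stmt3 (t : ℝ) (ht : t ∈ Set.Ico (0:ℝ) 1) :
    ∃! c : ℝ, c > -(t * (1 - Real.log t)) ∧
      (∫ y in t..1, 1 / (c + y * (1 - Real.log y))) = 1 := by
  obtain ⟨ht0, ht1⟩ := ht
  obtain ⟨a, ha, ha1, hFa⟩ := exists_one_le_integral_one_div_add_mul_one_sub_log ht0 ht1
  obtain ⟨c, hc, hFc⟩ := intermediate_value_Icc' ha1
    ((continuousOn_integral_one_div_add_mul_one_sub_log ht0 ht1 ha).mono Set.Icc_subset_Ici_self)
    ⟨integral_one_div_one_add_mul_one_sub_log_le ht0 ht1, hFa⟩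
  have hc0 : -(t * (1 - Real.log t)) < c := ha.trans_le hc.1
  refine ⟨c, ⟨hc0, hFc⟩, ?_⟩
  rintro d ⟨hd, hFd⟩
  rcases lt_trichotomy d c with h | h | h
  · have := integral_one_div_add_mul_one_sub_log_lt ht0 ht1 hd h
    simp only at hFc
    linarith
  · exact h
  · have := integral_one_div_add_mul_one_sub_log_lt ht0 ht1 hc0 h
    simp only at hFc
    linarith
end

section
/- Let c* > 0 be the unique real number with ∫_0^1 1/(c* + y(1 − ln y)) dy = 1, and for t ∈ (0,1) let c_t > −t(1 − ln t) be the unique real with ∫_t^1 1/(c_t + y(1 − ln y)) dy = 1. Then there exist a constant K > 0 and t₀ ∈ (0,1) such that for all t ∈ [0, t₀]: c* − K·t ≤ c_t ≤ c*. Equivalently, writing β₀ = 1/(1+c*) and β_t = 1/(1+c_t), one has β₀ ≤ β_t ≤ β₀ + K·t for all t ∈ [0, t₀]. -/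
lemma monotoneOn_mul_one_sub_log :
    MonotoneOn (fun y : ℝ => y * (1 - Real.log y)) (Set.Icc 0 1) := by
  rintro x ⟨hx, -⟩ y ⟨hy, hy1⟩ hxy
  have hly : Real.log y ≤ 0 := Real.log_nonpos hy hy1
  rcases hx.eq_or_lt with rfl | hx
  · simpa using mul_nonneg hy (by linarith : (0:ℝ) ≤ 1 - Real.log y)
  · have hy0 : 0 < y := hx.trans_le hxy
    have hlog := Real.log_le_sub_one_of_pos (div_pos hy0 hx)
    rw [Real.log_div hy0.ne' hx.ne'] at hlog
    have hmul := mul_le_mul_of_nonneg_left hlog hx.le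
    have hcancel : x * (y / x - 1) = y - x := by field_simp
    rw [hcancel] at hmul
    dsimp only
    nlinarith [mul_nonneg (sub_nonneg.2 hxy) (neg_nonneg.2 hly)]

lemma add_mul_one_sub_log_pos {a t y : ℝ} (ht : 0 ≤ t)
    (ha : 0 < a + t * (1 - Real.log t)) (hy : y ∈ Set.Icc t 1) :
    0 < a + y * (1 - Real.log y) := by
  have h := monotoneOn_mul_one_sub_log ⟨ht, hy.1.trans hy.2⟩ ⟨ht.trans hy.1, hy.2⟩ hy.1
  dsimp only at h
  linarith

lemma intervalIntegrable_one_div_add_mul_one_sub_log {a t u v : ℝ} (ht : 0 ≤ t)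
    (ha : 0 < a + t * (1 - Real.log t)) (htu : t ≤ u) (huv : u ≤ v) (hv : v ≤ 1) :
    IntervalIntegrable (fun y => 1 / (a + y * (1 - Real.log y))) MeasureTheory.volume u v := by
  apply ContinuousOn.intervalIntegrable_of_Icc huv
  refine continuousOn_const.div
    (continuousOn_const.add continuous_mul_one_sub_log.continuousOn) fun y hy => ?_
  exact (add_mul_one_sub_log_pos ht ha ⟨htu.trans hy.1, hy.2.trans hv⟩).ne'

/-- The integral is decreasing in the additive constant, at a quantitative rate. -/
lemma le_integral_one_div_sub_integral_one_div {a b t : ℝ} (ht : 0 ≤ t) (ht1 : t ≤ 1)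
    (ha : 0 < a + t * (1 - Real.log t)) (hab : a ≤ b) :
    (1 - t) * ((b - a) / (b + 1) ^ 2) ≤
      (∫ y in t..1, 1 / (a + y * (1 - Real.log y))) -
        ∫ y in t..1, 1 / (b + y * (1 - Real.log y)) := by
  have hb : 0 < b + t * (1 - Real.log t) := by linarith
  have hIa := intervalIntegrable_one_div_add_mul_one_sub_log ht ha le_rfl ht1 le_rfl
  have hIb := intervalIntegrable_one_div_add_mul_one_sub_log ht hb le_rfl ht1 le_rfl
  rw [← intervalIntegral.integral_sub hIa hIb, ← smul_eq_mul,
    ← intervalIntegral.integral_const]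
  refine intervalIntegral.integral_mono_on ht1 intervalIntegrable_const (hIa.sub hIb)
    fun y hy => ?_
  have hya := add_mul_one_sub_log_pos ht ha hy
  have hyb := add_mul_one_sub_log_pos ht hb hy
  have hy1 := monotoneOn_mul_one_sub_log ⟨ht.trans hy.1, hy.2⟩
    (Set.right_mem_Icc.2 zero_le_one) hy.2
  simp only [Real.log_one, sub_zero, mul_one] at hy1
  rw [div_sub_div _ _ hya.ne' hyb.ne']
  have hnum : 1 * (b + y * (1 - Real.log y)) - (a + y * (1 - Real.log y)) * 1 = b - a := by ring
  rw [hnum, sq]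
  exact div_le_div_of_nonneg_left (by linarith) (mul_pos hya hyb)
    (mul_le_mul (by linarith) (by linarith) hyb.le (by linarith))

/-- Quantitative content of Lemma `modifiedbetabound`: `c* − K·t ≤ c_t ≤ c*` for all
small enough `t`, i.e. `β_t = β₀ + O(t)`. -/
theorem stmt5 (cstar : ℝ) (hcstar : 0 < cstar)
    (hint : (∫ y in (0:ℝ)..1, 1 / (cstar + y * (1 - Real.log y))) = 1)
    (c : ℝ → ℝ) (hc0 : c 0 = cstar)
    (hc : ∀ t ∈ Set.Ioo (0:ℝ) 1, c t > -(t * (1 - Real.log t)) ∧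
      (∫ y in t..1, 1 / (c t + y * (1 - Real.log y))) = 1) :
    ∃ K > (0:ℝ), ∃ t₀ ∈ Set.Ioo (0:ℝ) 1, ∀ t ∈ Set.Icc (0:ℝ) t₀,
      cstar - K * t ≤ c t ∧ c t ≤ cstar := by
  refine ⟨2 * (cstar + 1) ^ 2 / cstar, by positivity, 1 / 2, by norm_num, ?_⟩
  rintro t ⟨ht, ht2⟩
  rcases ht.eq_or_lt with rfl | ht0
  · simp [hc0]
  obtain ⟨hct, hceq⟩ := hc t ⟨ht0, by linarith⟩
  have hstar : 0 < cstar + 0 * (1 - Real.log 0) := by simpa using hcstar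
  have hI₁ := intervalIntegrable_one_div_add_mul_one_sub_log le_rfl hstar le_rfl ht
    (by linarith)
  have hI₂ := intervalIntegrable_one_div_add_mul_one_sub_log le_rfl hstar ht
    (by linarith : t ≤ 1) le_rfl
  have hsplit := intervalIntegral.integral_add_adjacent_intervals hI₁ hI₂
  rw [hint] at hsplit
  have hh : ∀ y ∈ Set.Icc 0 t, 0 ≤ y * (1 - Real.log y) := fun y hy =>
    mul_nonneg hy.1 (by linarith [Real.log_nonpos hy.1 (by linarith [hy.2])])
  have hnonneg : 0 ≤ ∫ y in (0:ℝ)..t, 1 / (cstar + y * (1 - Real.log y)) :=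
    intervalIntegral.integral_nonneg ht fun y hy => by have := hh y hy; positivity
  have hle : (∫ y in (0:ℝ)..t, 1 / (cstar + y * (1 - Real.log y))) ≤ t * (1 / cstar) := by
    have h := intervalIntegral.integral_mono_on ht hI₁
      (intervalIntegrable_const (c := 1 / cstar)) fun y hy =>
        one_div_le_one_div_of_le hcstar (by linarith [hh y hy])
    simpa using h
  have hupper : c t ≤ cstar := by
    by_contra! hlt
    have h := le_integral_one_div_sub_integral_one_div ht (by linarith)
      (by linarith [hh t ⟨ht, le_rfl⟩]) hlt.le
    rw [hceq] at h
    have hpos : 0 < (1 - t) * ((c t - cstar) / (c t + 1) ^ 2) :=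
      mul_pos (by linarith) (div_pos (by linarith) (pow_pos (by linarith) 2))
    linarith
  refine ⟨?_, hupper⟩
  have h := le_integral_one_div_sub_integral_one_div ht (by linarith) (by linarith) hupper
  rw [hceq] at h
  have hhalf : 1 / 2 * ((cstar - c t) / (cstar + 1) ^ 2) ≤
      (1 - t) * ((cstar - c t) / (cstar + 1) ^ 2) :=
    mul_le_mul_of_nonneg_right (by linarith) (div_nonneg (by linarith) (by positivity))
  have hfrac : (cstar - c t) / (cstar + 1) ^ 2 ≤ 2 * t / cstar := by
    have : 2 * t / cstar = 2 * (t * (1 / cstar)) := by ring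
    linarith
  rw [div_le_iff₀ (by positivity)] at hfrac
  have : 2 * (cstar + 1) ^ 2 / cstar * t = 2 * t / cstar * (cstar + 1) ^ 2 := by ring
  linarith
end

section
/- Let c > 0 and let y : [0,1] → ℝ be differentiable with y(0) = 1, with 0 < y(t) ≤ 1 for all t ∈ [0,1], and satisfying the differential equation y'(t) = y(t)(ln y(t) − 1) − c for all t ∈ [0,1]. Then: (i) −(1 + c) ≤ y'(t) ≤ −c for all t ∈ [0,1]; (ii) 1 − (1 + c)·t ≤ y(t) ≤ 1 − c·t for all t ∈ [0,1]; and (iii) for every t ∈ [0,1] such that y(s) ≥ 1/e for all s ∈ [0,t], one has y(t) ≤ 1 − (1 + c)·t + (1 + c)·t²/2. -/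
theorem le_of_hasDerivAt_le {f g f' g' : ℝ → ℝ} {a b : ℝ}
    (hf : ∀ x ∈ Set.Icc a b, HasDerivAt f (f' x) x)
    (hg : ∀ x ∈ Set.Icc a b, HasDerivAt g (g' x) x)
    (ha : f a ≤ g a) (hle : ∀ x ∈ Set.Icc a b, f' x ≤ g' x) :
    ∀ x ∈ Set.Icc a b, f x ≤ g x := fun _ hx =>
  image_le_of_deriv_right_le_deriv_boundary
    (fun x hx => (hf x hx).continuousAt.continuousWithinAt)
    (fun x hx => (hf x (Set.Ico_subset_Icc_self hx)).hasDerivWithinAt) ha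
    (fun x hx => (hg x hx).continuousAt.continuousWithinAt)
    (fun x hx => (hg x (Set.Ico_subset_Icc_self hx)).hasDerivWithinAt)
    (fun x hx => hle x (Set.Ico_subset_Icc_self hx)) hx

theorem neg_one_le_mul_log_sub_one {x : ℝ} (hx : 0 < x) : -1 ≤ x * (Real.log x - 1) := by
  have h := mul_le_mul_of_nonneg_left (Real.one_sub_inv_le_log_of_pos hx) hx.le
  rw [mul_sub, mul_inv_cancel₀ hx.ne'] at h
  linarith

theorem mul_log_sub_one_le_neg {x : ℝ} (hx : 0 < x) (hx1 : x ≤ 1) :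
    x * (Real.log x - 1) ≤ -x := by
  have h := mul_nonpos_of_nonneg_of_nonpos hx.le (Real.log_nonpos hx.le hx1)
  linarith

theorem hasDerivAt_one_sub_mul (k x : ℝ) : HasDerivAt (fun t : ℝ => 1 - k * t) (-k) x := by
  simpa using ((hasDerivAt_id x).const_mul k).const_sub 1


/-- Observation `tilde-y-derivative-bounds`: derivative pinning and linear/quadratic
envelopes for the solution of `y' = y(ln y − 1) − c` with `y(0) = 1`. -/
theorem stmt7 (c : ℝ) (hc : 0 < c) (y : ℝ → ℝ)
    (hy0 : y 0 = 1)
    (hypos : ∀ t ∈ Set.Icc (0:ℝ) 1, 0 < y t ∧ y t ≤ 1)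
    (hderiv : ∀ t ∈ Set.Icc (0:ℝ) 1, HasDerivAt y (y t * (Real.log (y t) - 1) - c) t) :
    (∀ t ∈ Set.Icc (0:ℝ) 1, -(1 + c) ≤ deriv y t ∧ deriv y t ≤ -c) ∧
    (∀ t ∈ Set.Icc (0:ℝ) 1, 1 - (1 + c) * t ≤ y t ∧ y t ≤ 1 - c * t) ∧
    (∀ t ∈ Set.Icc (0:ℝ) 1, (∀ s ∈ Set.Icc (0:ℝ) t, 1 / Real.exp 1 ≤ y s) →
      y t ≤ 1 - (1 + c) * t + (1 + c) * t ^ 2 / 2) := by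
  have lower : ∀ t ∈ Set.Icc (0:ℝ) 1, -(1 + c) ≤ y t * (Real.log (y t) - 1) - c :=
    fun t ht => by linarith [neg_one_le_mul_log_sub_one (hypos t ht).1]
  have upper : ∀ t ∈ Set.Icc (0:ℝ) 1, y t * (Real.log (y t) - 1) - c ≤ -y t - c :=
    fun t ht => by linarith [mul_log_sub_one_le_neg (hypos t ht).1 (hypos t ht).2]
  have upper' : ∀ t ∈ Set.Icc (0:ℝ) 1, y t * (Real.log (y t) - 1) - c ≤ -c :=
    fun t ht => by linarith [upper t ht, (hypos t ht).1]
  have linear_le : ∀ t ∈ Set.Icc (0:ℝ) 1, 1 - (1 + c) * t ≤ y t :=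
    le_of_hasDerivAt_le (fun x _ => hasDerivAt_one_sub_mul (1 + c) x) hderiv
      (by simp [hy0]) lower
  refine ⟨fun t ht => ?_, fun t ht => ⟨linear_le t ht, ?_⟩, fun t ht _ => ?_⟩
  · rw [(hderiv t ht).deriv]
    exact ⟨lower t ht, upper' t ht⟩
  · exact le_of_hasDerivAt_le hderiv (fun x _ => hasDerivAt_one_sub_mul c x)
      (by simp [hy0]) upper' t ht
  · -- Since `y * log y ≤ 0`, the linear lower bound on `y` already bounds `y'` from above.
    refine le_of_hasDerivAt_le (g := fun t => 1 - (1 + c) * t + (1 + c) * t ^ 2 / 2)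
      (g' := fun t => -(1 + c) + (1 + c) * t) hderiv (fun x _ => ?_) (by simp [hy0])
      (fun x hx => ?_) t ht
    · refine ((hasDerivAt_one_sub_mul (1 + c) x).add
        (((hasDerivAt_pow 2 x).const_mul (1 + c)).div_const 2)).congr_deriv ?_
      norm_num
      ring
    · linarith [upper x hx, linear_le x hx]
end

section
/- For every real n ≥ 7, setting λ = n − √(n·ln n), one has exp(−(n − λ)²/(2n)) + ∑_{ℓ=2}^∞ exp(−(ℓn − λ)²/(2ℓn)) ≤ 2/√n. -/
lemma exp_neg_sq_div_le_geometric {n lam : ℝ} (hn : 0 < n) (hlam : lam ≤ n) (ℓ : ℕ) :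
    Real.exp (-(((ℓ : ℝ) + 2) * n - lam) ^ 2 / (2 * ((ℓ : ℝ) + 2) * n))
      ≤ Real.exp (-(n / 4)) * Real.exp (-(n / 4)) ^ ℓ := by
  have hℓ : (0 : ℝ) ≤ ℓ := ℓ.cast_nonneg
  rw [← Real.exp_nat_mul, ← Real.exp_add, Real.exp_le_exp, div_le_iff₀ (by positivity)]
  have hsq : (((ℓ : ℝ) + 1) * n) ^ 2 ≤ (((ℓ : ℝ) + 2) * n - lam) ^ 2 :=
    pow_le_pow_left₀ (by positivity) (by linarith) 2
  have hℓn : 0 ≤ (ℓ : ℝ) * (ℓ + 1) * n ^ 2 := by positivity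
  linarith

lemma geometric_exp_neg_le_inv_sqrt {n : ℝ} (hn : 7 ≤ n) :
    Real.exp (-(n / 4)) * (1 - Real.exp (-(n / 4)))⁻¹ ≤ 1 / √n := by
  have hs : 5 / 2 ≤ √n := Real.le_sqrt_of_sq_le (by linarith)
  have hsn : √n ^ 2 = n := Real.sq_sqrt (by linarith)
  have hexp : 1 + √n ≤ Real.exp (n / 4) := by
    have h := Real.quadratic_le_exp_of_nonneg (show 0 ≤ n / 4 by linarith)
    nlinarith [mul_nonneg (sub_nonneg.2 hs) (sub_nonneg.2 hs)]
  have hlt : Real.exp (-(n / 4)) < 1 := Real.exp_lt_one_iff.2 (by linarith)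
  have hinv : Real.exp (-(n / 4)) * Real.exp (n / 4) = 1 := by
    rw [← Real.exp_add, neg_add_cancel, Real.exp_zero]
  rw [← div_eq_mul_inv, div_le_div_iff₀ (by linarith) (by linarith)]
  have h := mul_le_mul_of_nonneg_left hexp (Real.exp_pos (-(n / 4))).le
  linarith

/-- Summation bound in the proof of Lemma `good-poisson-implies-good-fixed-n`:
for `n ≥ 7` and `λ = n − √(n ln n)`,
`exp(−(n−λ)²/(2n)) + ∑_{ℓ≥2} exp(−(ℓn−λ)²/(2ℓn)) ≤ 2/√n`. -/
theorem stmt9 (n lam : ℝ) (hn : 7 ≤ n) (hlam : lam = n - Real.sqrt (n * Real.log n)) :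
    Real.exp (-(n - lam) ^ 2 / (2 * n)) +
      (∑' ℓ : ℕ, Real.exp (-(((ℓ : ℝ) + 2) * n - lam) ^ 2 / (2 * ((ℓ : ℝ) + 2) * n)))
      ≤ 2 / Real.sqrt n := by
  have hn0 : 0 < n := by linarith
  have hlog : 0 ≤ Real.log n := Real.log_nonneg (by linarith)
  have hle : lam ≤ n := by
    have := Real.sqrt_nonneg (n * Real.log n)
    linarith
  have hfirst : Real.exp (-(n - lam) ^ 2 / (2 * n)) = 1 / √n := by
    have hsq : (n - lam) ^ 2 = n * Real.log n := by
      rw [hlam, sub_sub_cancel, Real.sq_sqrt (by positivity)]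
    have harg : -(n * Real.log n) / (2 * n) = -(Real.log n / 2) := by
      field_simp
    rw [hsq, harg, Real.exp_neg, ← Real.log_sqrt hn0.le, Real.exp_log (Real.sqrt_pos.2 hn0),
      one_div]
  have hgeom := (hasSum_geometric_of_lt_one (Real.exp_pos (-(n / 4))).le
    (Real.exp_lt_one_iff.2 (by linarith))).mul_left (Real.exp (-(n / 4)))
  have hbound := exp_neg_sq_div_le_geometric hn0 hle
  have hsum := Summable.of_nonneg_of_le (fun _ => (Real.exp_pos _).le) hbound hgeom.summable
  have htail := hsum.tsum_le_tsum hbound hgeom.summable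
  rw [hgeom.tsum_eq] at htail
  calc _ ≤ 1 / √n + 1 / √n :=
        add_le_add hfirst.le (htail.trans (geometric_exp_neg_le_inv_sqrt hn))
    _ = 2 / √n := by ring
end

section
/- For every natural number n ≥ 10, setting λ = n − √(n·ln n), for every p ∈ [0,1]: 1 − e^{−λp} ≥ (1 − (1 + 2√(ln n))/√n) · (1 − (1 − p)^n). -/
/-- Concavity of `y ↦ 1 - e^{-y}`, vanishing at `0`. -/
theorem mul_one_sub_exp_neg_le {t : ℝ} (ht0 : 0 ≤ t) (ht1 : t ≤ 1) (y : ℝ) :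
    t * (1 - Real.exp (-y)) ≤ 1 - Real.exp (-(t * y)) := by
  have h := convexOn_exp.2 (Set.mem_univ (-y)) (Set.mem_univ 0) ht0 (sub_nonneg.2 ht1) (by ring)
  simp only [smul_eq_mul, mul_zero, add_zero, Real.exp_zero, mul_one] at h
  rw [← mul_neg]
  linarith

theorem exp_neg_div_one_sub_le_pow {p : ℝ} (hp : p < 1) (n : ℕ) :
    Real.exp (-(n * (p / (1 - p)))) ≤ (1 - p) ^ n := by
  have hp' : 0 < 1 - p := sub_pos.2 hp
  have h : (1 - p)⁻¹ ≤ Real.exp (p / (1 - p)) := by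
    have := Real.add_one_le_exp (p / (1 - p))
    have e : p / (1 - p) + 1 = (1 - p)⁻¹ := by field_simp; ring
    rwa [e] at this
  rw [← mul_neg, Real.exp_nat_mul, Real.exp_neg]
  exact pow_le_pow_left₀ (by positivity) (inv_le_of_inv_le₀ hp' h) n

theorem three_halves_mul_sqrt_log_le_sqrt {x : ℝ} (hx : 1 ≤ x) :
    3 / 2 * √(Real.log x) ≤ √x := by
  have hx0 : 0 < x := by linarith
  have h : Real.log x ≤ x * Real.exp (-1) := by
    have := Real.log_le_sub_one_of_pos (mul_pos hx0 (Real.exp_pos (-1)))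
    rw [Real.log_mul hx0.ne' (Real.exp_pos _).ne', Real.log_exp] at this
    linarith
  have he : Real.exp (-1) < 4 / 9 := by
    have := Real.exp_neg_one_lt_d9
    linarith
  apply Real.le_sqrt_of_sq_le
  rw [mul_pow, Real.sq_sqrt (Real.log_nonneg hx)]
  nlinarith

/-- Analytic content of the coupling claim in Lemma `good-poisson-implies-good-fixed-n`:
for `n ≥ 10`, `λ = n − √(n ln n)` and `p ∈ [0,1]`,
`1 − e^{−λp} ≥ (1 − (1 + 2√(ln n))/√n)(1 − (1−p)ⁿ)`. -/
theorem stmt10 (n : ℕ) (hn : 10 ≤ n) (p : ℝ) (hp : p ∈ Set.Icc (0:ℝ) 1)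
    (lam : ℝ) (hlam : lam = (n : ℝ) - Real.sqrt ((n : ℝ) * Real.log (n : ℝ))) :
    (1 - (1 + 2 * Real.sqrt (Real.log (n : ℝ))) / Real.sqrt (n : ℝ)) * (1 - (1 - p) ^ n)
      ≤ 1 - Real.exp (-(lam * p)) := by
  obtain ⟨hp0, hp1⟩ := hp
  have hn1 : (1 : ℝ) ≤ n := by exact_mod_cast (by omega : 1 ≤ n)
  have hn0 : (0 : ℝ) < n := by linarith
  rw [Real.sqrt_mul hn0.le] at hlam
  have hLs := three_halves_mul_sqrt_log_le_sqrt hn1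
  have hexp : Real.exp (-(√(Real.log n) ^ 2 / 2)) = 1 / √(n : ℝ) := by
    rw [Real.sq_sqrt (Real.log_nonneg hn1), ← Real.log_sqrt hn0.le, Real.exp_neg,
      Real.exp_log (Real.sqrt_pos.2 hn0), one_div]
  have hs : 0 < √(n : ℝ) := Real.sqrt_pos.2 hn0
  have hns : (n : ℝ) = √(n : ℝ) ^ 2 := (Real.sq_sqrt hn0.le).symm
  have hL : 0 ≤ √(Real.log n) := Real.sqrt_nonneg _
  set s := √(n : ℝ)
  set L := √(Real.log n)
  have hlam' : lam = s * (s - L) := by rw [hlam, hns]; ring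
  have hlam0 : 0 ≤ lam := by rw [hlam']; exact mul_nonneg hs.le (by linarith)
  have hpow0 : 0 ≤ (1 - p) ^ n := pow_nonneg (by linarith) n
  have hpow1 : (1 - p) ^ n ≤ 1 := pow_le_one₀ (by linarith) (by linarith)
  rcases le_or_gt (1 - (1 + 2 * L) / s) 0 with hc | hc
  · have : Real.exp (-(lam * p)) ≤ 1 := Real.exp_le_one_iff.2 (by nlinarith)
    nlinarith
  rcases le_or_gt p ((1 + L) / s) with hps | hps
  · have hc' : (1 + 2 * L) / s = (1 + L) / s + L / s := by ring
    have hLs0 : 0 ≤ L / s := by positivity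
    have hLs1 : L / s ≤ 1 := (div_le_one hs).2 (by linarith)
    have hplt : p < 1 := by linarith
    have hp' : 0 < 1 - p := by linarith
    have ht0 : 0 ≤ (1 - L / s) * (1 - p) := mul_nonneg (by linarith) hp'.le
    have ht1 : (1 - L / s) * (1 - p) ≤ 1 := by nlinarith
    have key := mul_one_sub_exp_neg_le ht0 ht1 (n * (p / (1 - p)))
    have hy : (1 - L / s) * (1 - p) * (n * (p / (1 - p))) = lam * p := by
      rw [hlam', hns]
      field_simp
    rw [hy] at key
    have hq := exp_neg_div_one_sub_le_pow hplt n
    refine le_trans (mul_le_mul ?_ ?_ ?_ ht0) key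
    · nlinarith
    · linarith
    · linarith
  · have h1 : L ^ 2 / 2 ≤ lam * p := by
      have : lam * ((1 + L) / s) ≤ lam * p := mul_le_mul_of_nonneg_left hps.le hlam0
      have e : lam * ((1 + L) / s) = (s - L) * (1 + L) := by rw [hlam']; field_simp
      nlinarith
    have h2 : Real.exp (-(lam * p)) ≤ 1 / s := by
      rw [← hexp]
      exact Real.exp_le_exp.2 (by linarith)
    have h3 : 1 / s ≤ (1 + 2 * L) / s := by
      gcongr
      linarith
    nlinarith
end

section
/- There exist γ ∈ (0, 1/e), τ₁ ∈ (0, 1/e) and τ₂ ∈ (1/e, 1) with τ₁·ln(1/τ₁) = γ and τ₂·ln(1/τ₂) = γ, such that γ + e^{−τ₁} − e^{−τ₂} > 1 − 1/e. -/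
/-- The consistency guarantee `γ + e^{−τ₁} − e^{−τ₂}` of ThreePhase strictly exceeds
`1 − 1/e` for some `γ ∈ (0, 1/e)` with corresponding solutions `τ₁, τ₂` of `τ ln(1/τ) = γ`. -/
theorem stmt12 :
    ∃ γ τ₁ τ₂ : ℝ, γ ∈ Set.Ioo (0:ℝ) (Real.exp 1)⁻¹ ∧
      τ₁ ∈ Set.Ioo (0:ℝ) (Real.exp 1)⁻¹ ∧ τ₂ ∈ Set.Ioo ((Real.exp 1)⁻¹) 1 ∧
      τ₁ * Real.log (1 / τ₁) = γ ∧ τ₂ * Real.log (1 / τ₂) = γ ∧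
      1 - (Real.exp 1)⁻¹ < γ + Real.exp (-τ₁) - Real.exp (-τ₂) := by
  have he := Real.exp_one_lt_d9
  have he' := Real.exp_one_gt_d9
  have hinv_lt : (Real.exp 1)⁻¹ < 0.3679 := by
    rw [inv_lt_comm₀ (by positivity) (by norm_num)]
    norm_num at he' ⊢; linarith
  have hinv_gt : 0.36 < (Real.exp 1)⁻¹ := by
    rw [lt_inv_comm₀ (by norm_num) (by positivity)]
    norm_num at he ⊢; linarith
  have hexp3 : Real.exp (-3) = (Real.exp 1)⁻¹ ^ 3 := by
    rw [← Real.exp_neg, ← Real.exp_nat_mul]; norm_num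
  have hexp3_gt : (0.04 : ℝ) < Real.exp (-3) := by
    rw [hexp3]
    calc (0.04 : ℝ) < 0.36 ^ 3 := by norm_num
      _ < _ := by gcongr
  have hmul (x : ℝ) : x * Real.log (1 / x) = Real.negMulLog x := by
    rw [one_div, Real.log_inv, Real.negMulLog]; ring
  -- The larger solution is `0.95`; the smaller one lies in `(0, e⁻³]`.
  obtain ⟨γ, hγ⟩ : ∃ γ, γ = Real.negMulLog 0.95 := ⟨_, rfl⟩
  have hγ_gt : 0.0475 ≤ γ := by
    have := Real.log_le_sub_one_of_pos (x := 0.95) (by norm_num)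
    rw [hγ, Real.negMulLog]; linarith
  have hγ_le : γ ≤ 0.05 := by
    have := Real.one_sub_inv_le_log_of_pos (x := 0.95) (by norm_num)
    rw [hγ, Real.negMulLog]; norm_num at this ⊢; linarith
  obtain ⟨τ, ⟨hτ0, hτ3⟩, hτγ⟩ : γ ∈ Real.negMulLog '' Set.Icc 0 (Real.exp (-3)) := by
    refine intermediate_value_Icc (Real.exp_pos _).le Real.continuous_negMulLog.continuousOn
      ⟨?_, ?_⟩
    · rw [Real.negMulLog_zero]; linarith
    · rw [Real.negMulLog, Real.log_exp]; linarith
  have hτpos : 0 < τ := by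
    rcases hτ0.eq_or_lt with h | h
    · rw [← h, Real.negMulLog_zero] at hτγ; linarith
    · exact h
  have hτ_le : 3 * τ ≤ γ := by
    have hlog : Real.log τ ≤ -3 := (Real.log_le_iff_le_exp hτpos).2 hτ3
    rw [← hτγ, Real.negMulLog]; nlinarith
  refine ⟨γ, τ, 0.95, ⟨by linarith, by linarith⟩, ⟨hτpos, by linarith⟩,
    ⟨by linarith, by norm_num⟩, by rw [hmul, hτγ], by rw [hmul, hγ], ?_⟩
  have h1 := Real.one_sub_le_exp_neg τ
  have h2 : Real.exp (-0.95) ≤ (Real.exp 1)⁻¹ * (20 / 19) := by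
    have h3 : Real.exp (-0.95) = (Real.exp 1)⁻¹ * (Real.exp (-0.05))⁻¹ := by
      rw [← Real.exp_neg, ← Real.exp_neg, ← Real.exp_add]; norm_num
    have h4 : (Real.exp (-0.05))⁻¹ ≤ 20 / 19 := by
      have := Real.one_sub_le_exp_neg 0.05
      rw [inv_le_comm₀ (by positivity) (by norm_num)]
      norm_num at this ⊢; linarith
    rw [h3]; gcongr
  linarith
end
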